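/- arXiv:2309.03998 — 3 statements merged into one kernel-verified Lean document; each statement's English description precedes it below -/
import Mathlib

section
/- Consider the saddle-point problem min_x max_y f(x) + ⟨Lx, y⟩ − g*(y) admitting a KKT point (x⋆, y⋆), i.e. −L*y⋆ ∈ ∂f(x⋆) and Lx⋆ ∈ ∂g*(y⋆). Let (x_k), (y_k) be generated by the Chambolle–Pock iteration x_{k+1} = prox_{τf}(x_k − τ L* y_k), y_{k+1} = prox_{σ g*}(y_k + σ L(x_{k+1} + θ(x_{k+1} − x_k))) from an arbitrary initial point (x₀, y₀), with θ ≥ 1/2 and τ, σ > 0 satisfying τσ‖L‖² ≤ 4/(1 + 2θ), where at least one of the two inequalities θ ≥ 1/2 and τσ‖L‖² ≤ 4/(1 + 2θ) is strict. Let x̄_K = (1/K)∑_{k=1}^{K} x_k and ȳ_K = (1/K)∑_{k=1}^{K} y_k. Then there exists a constant C ≥ 0 (one may take C = V₀, the initial value of the Lyapunov function) such that for every positive integer K, the ergodic primal–dual gap satisfies D_{x⋆,y⋆}(x̄_K, ȳ_K) ≤ C/K; in particular it converges to 0 at rate O(1/K). -/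
open scoped RealInnerProductSpace
open Filter Topology

noncomputable section

/-- The convex subdifferential of an extended-real-valued function:
`∂f(x) = { u : ∀ z, f z ≥ f x + ⟪u, z - x⟫ }`. -/
def ESubdiff {E : Type*} [NormedAddCommGroup E] [InnerProductSpace ℝ E]
    (f : E → EReal) (x : E) : Set E :=
  {u | ∀ z : E, f x + ((⟪u, z - x⟫ : ℝ) : EReal) ≤ f z}

/-- Properness of an extended-real-valued function: it never takes the value `⊥`
and is not identically `⊤`. -/
def EProper {E : Type*} (f : E → EReal) : Prop :=
  (∃ x, f x ≠ ⊤) ∧ ∀ x, f x ≠ ⊥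

/-- Convexity of an extended-real-valued function. -/
def EConvex {E : Type*} [NormedAddCommGroup E] [NormedSpace ℝ E] (f : E → EReal) : Prop :=
  ∀ x y : E, ∀ a b : ℝ, 0 ≤ a → 0 ≤ b → a + b = 1 →
    f (a • x + b • y) ≤ (a : EReal) * f x + (b : EReal) * f y

/-- The convex (Fenchel) conjugate `g*(y) = sup_x (⟪x, y⟫ - g x)`. -/
def EConj {E : Type*} [NormedAddCommGroup E] [InnerProductSpace ℝ E]
    (g : E → EReal) (y : E) : EReal :=
  ⨆ x : E, ((⟪x, y⟫ : ℝ) : EReal) - g x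

/-- `IsProx τ f x p` states that `p = prox_{τ f}(x)`, i.e. `p` minimizes
`fun z => f z + (1/(2τ)) ‖z - x‖²`. -/
def IsProx {E : Type*} [NormedAddCommGroup E] [InnerProductSpace ℝ E]
    (τ : ℝ) (f : E → EReal) (x p : E) : Prop :=
  ∀ z : E, f p + ((1 / (2 * τ) * ‖p - x‖ ^ 2 : ℝ) : EReal)
      ≤ f z + ((1 / (2 * τ) * ‖z - x‖ ^ 2 : ℝ) : EReal)

/-- The Lagrangian `𝓛(x, y) = f x + ⟪y, L x⟫ - g*(y)` of the saddle-point problem. -/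
def Lagr {E F : Type*} [NormedAddCommGroup E] [InnerProductSpace ℝ E]
    [NormedAddCommGroup F] [InnerProductSpace ℝ F]
    (f : E → EReal) (gs : F → EReal) (L : E →L[ℝ] F) (x : E) (y : F) : EReal :=
  f x + ((⟪y, L x⟫ : ℝ) : EReal) - gs y

theorem EProper.exists_real {α : Type*} {f : α → EReal} (hf : EProper f) {x : α} (hx : f x ≠ ⊤) :
    ∃ r : ℝ, f x = r :=
  ⟨(f x).toReal, (EReal.coe_toReal hx (hf.2 x)).symm⟩

section ExtendedReal

variable {E : Type*} [NormedAddCommGroup E] [InnerProductSpace ℝ E]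

theorem IsProx.ne_top {τ : ℝ} {f : E → EReal} {u p z : E} (h : IsProx τ f u p)
    (hz : f z ≠ ⊤) : f p ≠ ⊤ := by
  intro hp
  have h' := h z
  rw [hp, EReal.top_add_coe, top_le_iff] at h'
  exact EReal.add_ne_top hz (EReal.coe_ne_top _) h'

/-- A proximal point satisfies the subgradient inequality `(u - p) / τ ∈ ∂f(p)`. -/
theorem IsProx.add_inner_le {τ : ℝ} {f : E → EReal} {u p z : E} {a b : ℝ} (hτ : 0 < τ)
    (hf : EConvex f) (h : IsProx τ f u p) (hp : f p = a) (hz : f z = b) :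
    a + τ⁻¹ * ⟪u - p, z - p⟫ ≤ b := by
  have key : ∀ t : ℝ, 0 < t → t ≤ 1 →
      a + τ⁻¹ * ⟪u - p, z - p⟫ - b ≤ t * (1 / (2 * τ) * ‖z - p‖ ^ 2) := by
    intro t ht ht1
    have h1 := h ((1 - t) • p + t • z)
    have h2 := hf p z (1 - t) t (by linarith) ht.le (by ring)
    rw [hp, hz] at h2
    have h3 := h1.trans (add_le_add_left h2 _)
    rw [hp] at h3
    norm_cast at h3
    have e : (1 - t) • p + t • z - u = t • (z - p) - (u - p) := by module
    rw [e, norm_sub_rev p u, norm_sub_sq_real (t • (z - p)), real_inner_smul_left,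
      norm_smul, mul_pow, Real.norm_eq_abs, sq_abs, real_inner_comm] at h3
    have e2 : 1 / (2 * τ) * 2 = τ⁻¹ := by field_simp
    have h4 : t * (a + τ⁻¹ * ⟪u - p, z - p⟫ - b)
        ≤ t * (t * (1 / (2 * τ) * ‖z - p‖ ^ 2)) := by
      rw [← e2]
      linarith
    exact le_of_mul_le_mul_left h4 ht
  set A := a + τ⁻¹ * ⟪u - p, z - p⟫ - b with hA
  set B := 1 / (2 * τ) * ‖z - p‖ ^ 2
  have hB : 0 ≤ B := by positivity
  by_contra! hlt
  have hApos : 0 < A := by linarith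
  have h5 := key (A / (2 * (A + B))) (by positivity) (by
    rw [div_le_one (by positivity)]; linarith)
  rw [div_mul_eq_mul_div, le_div_iff₀ (by positivity)] at h5
  nlinarith [mul_nonneg hApos.le hB, mul_pos hApos hApos]

theorem EProper.conj_ne_bot {g : E → EReal} (hg : EProper g) (y : E) : EConj g y ≠ ⊥ := by
  obtain ⟨x, hx⟩ := hg.1
  obtain ⟨r, hr⟩ := hg.exists_real hx
  have h := le_iSup (fun x : E => ((⟪x, y⟫ : ℝ) : EReal) - g x) x
  intro hbot
  simp only [hr, ← EReal.coe_sub] at h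
  exact EReal.coe_ne_bot _ (le_bot_iff.1 (h.trans_eq hbot))

theorem EProper.convex_conj {g : E → EReal} (hg : EProper g) : EConvex (EConj g) := by
  intro x y a b ha hb hab
  refine iSup_le fun z => ?_
  by_cases hz : g z = ⊤
  · simp [hz]
  obtain ⟨r, hr⟩ := hg.exists_real hz
  have hle : ∀ w : E, ((⟪z, w⟫ - r : ℝ) : EReal) ≤ EConj g w := fun w => by
    have h := le_iSup (fun v : E => ((⟪v, w⟫ : ℝ) : EReal) - g v) z
    rwa [hr, ← EReal.coe_sub] at h
  have e : ((⟪z, a • x + b • y⟫ : ℝ) : EReal) - g z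
      = (a : EReal) * ((⟪z, x⟫ - r : ℝ) : EReal) + (b : EReal) * ((⟪z, y⟫ - r : ℝ) : EReal) := by
    rw [hr, inner_add_right, real_inner_smul_right, real_inner_smul_right]
    norm_cast
    linear_combination r * hab
  rw [e]
  exact add_le_add (mul_le_mul_of_nonneg_left (hle x) (by exact_mod_cast ha))
    (mul_le_mul_of_nonneg_left (hle y) (by exact_mod_cast hb))

theorem EConvex.convex_epigraph {f : E → EReal} (hf : EConvex f) :
    Convex ℝ {q : E × ℝ | f q.1 ≤ q.2} := by
  rintro ⟨x, r⟩ hx ⟨y, s⟩ hy a b ha hb hab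
  refine (hf x y a b ha hb hab).trans ?_
  have h := add_le_add (mul_le_mul_of_nonneg_left hx (by exact_mod_cast ha : (0 : EReal) ≤ a))
    (mul_le_mul_of_nonneg_left hy (by exact_mod_cast hb : (0 : EReal) ≤ b))
  simpa using h

/-- Jensen's inequality for arithmetic means. -/
theorem EConvex.map_average_le {f : E → EReal} (hf : EConvex f) {v : ℕ → E} {r : ℕ → ℝ}
    (h : ∀ k, f (v k) = r k) {K : ℕ} (hK : 0 < K) :
    f ((K : ℝ)⁻¹ • ∑ k ∈ Finset.range K, v k)
      ≤ (((K : ℝ)⁻¹ * ∑ k ∈ Finset.range K, r k : ℝ) : EReal) := by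
  have hK' : (K : ℝ) ≠ 0 := by positivity
  have hm := hf.convex_epigraph.sum_mem (t := Finset.range K) (w := fun _ => (K : ℝ)⁻¹)
    (z := fun k => (v k, r k)) (fun _ _ => by positivity) (by simp [hK'])
    (fun k _ => (h k).le)
  rw [← Finset.smul_sum] at hm
  simpa [Prod.fst_sum, Prod.snd_sum] using hm

end ExtendedReal

section Descent

variable {E F : Type*} [NormedAddCommGroup E] [InnerProductSpace ℝ E]
  [NormedAddCommGroup F] [InnerProductSpace ℝ F]

/-- The Lyapunov function of the Chambolle–Pock iteration, for a saddle point at the origin, where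
`c` is the value of the primal gap at `x'`. -/
def lyapunov (L : E →L[ℝ] F) (τ σ θ c : ℝ) (x x' : E) (y : F) : ℝ :=
  θ * c + τ⁻¹ / 2 * ‖x'‖ ^ 2 + σ⁻¹ / 2 * ‖y + (σ * θ) • L (x' - x)‖ ^ 2
    + θ * τ⁻¹ / 2 * ‖x' - x‖ ^ 2 - σ * (4 * θ ^ 2 + 1) / 16 * ‖L (x' - x)‖ ^ 2

variable {L : E →L[ℝ] F} {τ σ θ : ℝ}

theorem stepsize_mul_norm_map_sq_le (hτ : 0 < τ) (hσ : 0 < σ) (hθ : 1 / 2 ≤ θ)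
    (hstep : τ * σ * ‖L‖ ^ 2 ≤ 4 / (1 + 2 * θ)) (v : E) :
    σ * (1 + 2 * θ) * ‖L v‖ ^ 2 ≤ 4 * τ⁻¹ * ‖v‖ ^ 2 := by
  have hθ' : 0 < 1 + 2 * θ := by linarith
  rw [le_div_iff₀ hθ'] at hstep
  have h1 : ‖L v‖ ^ 2 ≤ ‖L‖ ^ 2 * ‖v‖ ^ 2 := by
    rw [← mul_pow]; gcongr; exact L.le_opNorm v
  have h2 : σ * (1 + 2 * θ) * ‖L‖ ^ 2 ≤ 4 * τ⁻¹ := by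
    rw [← div_eq_mul_inv, le_div_iff₀ hτ]; linarith
  calc σ * (1 + 2 * θ) * ‖L v‖ ^ 2 ≤ σ * (1 + 2 * θ) * (‖L‖ ^ 2 * ‖v‖ ^ 2) := by gcongr
    _ = σ * (1 + 2 * θ) * ‖L‖ ^ 2 * ‖v‖ ^ 2 := by ring
    _ ≤ 4 * τ⁻¹ * ‖v‖ ^ 2 := by gcongr

theorem lyapunov_nonneg (hτ : 0 < τ) (hσ : 0 < σ) (hθ : 1 / 2 ≤ θ)
    (hL : ∀ v : E, σ * (1 + 2 * θ) * ‖L v‖ ^ 2 ≤ 4 * τ⁻¹ * ‖v‖ ^ 2)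
    {c : ℝ} (hc : 0 ≤ c) (x x' : E) (y : F) : 0 ≤ lyapunov L τ σ θ c x x' y := by
  have h := mul_le_mul_of_nonneg_left (hL (x' - x)) (by linarith : 0 ≤ θ / 8)
  have h1 : 0 ≤ σ * (2 * θ - 1) / 16 * ‖L (x' - x)‖ ^ 2 := by
    have : 0 ≤ 2 * θ - 1 := by linarith
    positivity
  have h2 : 0 ≤ θ * c + τ⁻¹ / 2 * ‖x'‖ ^ 2 + σ⁻¹ / 2 * ‖y + (σ * θ) • L (x' - x)‖ ^ 2 := by
    have : 0 ≤ θ := by linarith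
    positivity
  unfold lyapunov
  linarith

/-- One step of the Chambolle–Pock iteration decreases the Lyapunov function by at least the
primal–dual gap. -/
theorem lyapunov_add_le (hσ : 0 < σ) (hθ : 1 / 2 ≤ θ)
    (hL : ∀ v : E, σ * (1 + 2 * θ) * ‖L v‖ ^ 2 ≤ 4 * τ⁻¹ * ‖v‖ ^ 2)
    {x₀ x₁ x₂ : E} {y₀ y₁ : F} {c₁ c₂ d₁ : ℝ}
    (h₂ : c₂ + τ⁻¹ * ⟪x₁ - x₂, -x₂⟫ - ⟪y₁, L (-x₂)⟫ ≤ 0)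
    (h₂₁ : c₂ + τ⁻¹ * ⟪x₁ - x₂, x₁ - x₂⟫ - ⟪y₁, L (x₁ - x₂)⟫ ≤ c₁)
    (h₁₂ : c₁ + τ⁻¹ * ⟪x₀ - x₁, x₂ - x₁⟫ - ⟪y₀, L (x₂ - x₁)⟫ ≤ c₂)
    (h₁ : d₁ + σ⁻¹ * ⟪y₀ - y₁, -y₁⟫ + ⟪L (x₁ + θ • (x₁ - x₀)), -y₁⟫ ≤ 0) :
    lyapunov L τ σ θ c₂ x₁ x₂ y₁ + (c₁ + d₁) ≤ lyapunov L τ σ θ c₁ x₀ x₁ y₀ := by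
  have h₂₁' := mul_le_mul_of_nonneg_left h₂₁ (by linarith : 0 ≤ θ - 1 / 2)
  have hd := mul_le_mul_of_nonneg_left (hL (x₂ - x₁ - (x₁ - x₀)))
    (by linarith : 0 ≤ (2 * θ + 1) / 32)
  have hs := mul_le_mul_of_nonneg_left (hL (x₂ - x₁ + (x₁ - x₀)))
    (by linarith : 0 ≤ (2 * θ - 1) / 32)
  have hs' : 0 ≤ σ * (2 * θ - 1) / 16 * ‖L (x₂ - x₁ + (x₁ - x₀))‖ ^ 2 := by
    have : 0 ≤ 2 * θ - 1 := by linarith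
    positivity
  obtain ⟨η₀, rfl⟩ : ∃ η, y₀ = σ • η := ⟨σ⁻¹ • y₀, by rw [smul_inv_smul₀ hσ.ne']⟩
  obtain ⟨η₁, rfl⟩ : ∃ η, y₁ = σ • η := ⟨σ⁻¹ • y₁, by rw [smul_inv_smul₀ hσ.ne']⟩
  have hsq : 0 ≤ σ / 2 * ‖η₀ + θ • L (x₁ - x₀) - η₁ - (1 / 2 : ℝ) • L (x₂ - x₁)‖ ^ 2 := by
    positivity
  have e₀ : σ⁻¹ / 2 * ‖σ • η₀ + (σ * θ) • L (x₁ - x₀)‖ ^ 2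
      = σ / 2 * ‖η₀ + θ • L (x₁ - x₀)‖ ^ 2 := by
    rw [mul_smul, ← smul_add, norm_smul, mul_pow, Real.norm_eq_abs, sq_abs]
    field_simp
  have e₁ : σ⁻¹ / 2 * ‖σ • η₁ + (σ * θ) • L (x₂ - x₁)‖ ^ 2
      = σ / 2 * ‖η₁ + θ • L (x₂ - x₁)‖ ^ 2 := by
    rw [mul_smul, ← smul_add, norm_smul, mul_pow, Real.norm_eq_abs, sq_abs]
    field_simp
  have e₂ : σ⁻¹ * ⟪σ • η₀ - σ • η₁, -(σ • η₁)⟫ = σ * ⟪η₀ - η₁, -η₁⟫ := by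
    rw [← smul_sub, ← smul_neg, real_inner_smul_left, real_inner_smul_right]
    field_simp
  unfold lyapunov
  rw [e₀, e₁]
  rw [e₂] at h₁
  simp only [← real_inner_self_eq_norm_sq, map_sub, map_add, map_neg, map_smul, inner_add_left,
    inner_add_right, inner_sub_left, inner_sub_right, inner_neg_right,
    real_inner_smul_left, real_inner_smul_right, smul_sub,
    real_inner_comm x₀ x₁, real_inner_comm x₀ x₂, real_inner_comm x₁ x₂,
    real_inner_comm (L x₀) (L x₁), real_inner_comm (L x₀) (L x₂), real_inner_comm (L x₁) (L x₂),
    real_inner_comm η₀ η₁, fun i => real_inner_comm η₀ (L i),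
    fun i => real_inner_comm η₁ (L i)] at *
  linarith

end Descent

theorem chambolle_pock_ergodic_rate
    {𝓗 𝓖 : Type*}
    [NormedAddCommGroup 𝓗] [InnerProductSpace ℝ 𝓗] [CompleteSpace 𝓗]
    [NormedAddCommGroup 𝓖] [InnerProductSpace ℝ 𝓖] [CompleteSpace 𝓖]
    (f : 𝓗 → EReal) (g : 𝓖 → EReal) (gs : 𝓖 → EReal)
    (hf₁ : EProper f) (hf₂ : EConvex f) (hf₃ : LowerSemicontinuous f)
    (hg₁ : EProper g) (hg₂ : EConvex g) (hg₃ : LowerSemicontinuous g)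
    (hgs : gs = EConj g)
    (L : 𝓗 →L[ℝ] 𝓖) (hL : L ≠ 0)
    (τ σ θ : ℝ) (hτ : 0 < τ) (hσ : 0 < σ)
    (hθ : 1 / 2 ≤ θ) (hstep : τ * σ * ‖L‖ ^ 2 ≤ 4 / (1 + 2 * θ))
    (hstrict : 1 / 2 < θ ∨ τ * σ * ‖L‖ ^ 2 < 4 / (1 + 2 * θ))
    (xstar : 𝓗) (ystar : 𝓖)
    (hkkt₁ : -((ContinuousLinearMap.adjoint L) ystar) ∈ ESubdiff f xstar)
    (hkkt₂ : L xstar ∈ ESubdiff gs ystar)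
    (x : ℕ → 𝓗) (y : ℕ → 𝓖)
    (hx : ∀ k : ℕ, IsProx τ f (x k - τ • (ContinuousLinearMap.adjoint L) (y k)) (x (k + 1)))
    (hy : ∀ k : ℕ,
      IsProx σ gs (y k + σ • L (x (k + 1) + θ • (x (k + 1) - x k))) (y (k + 1)))
    :
    ∃ C : ℝ, 0 ≤ C ∧ ∀ K : ℕ, 0 < K →
      Lagr f gs L ((K : ℝ)⁻¹ • ∑ k ∈ Finset.range K, x (k + 1)) ystar
          - Lagr f gs L xstar ((K : ℝ)⁻¹ • ∑ k ∈ Finset.range K, y (k + 1))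
        ≤ ((C / K : ℝ) : EReal) := by
  have hgs_bot : ∀ w, gs w ≠ ⊥ := hgs ▸ hg₁.conj_ne_bot
  have hgs_conv : EConvex gs := hgs ▸ hg₁.convex_conj
  by_cases hys : gs ystar = ⊤
  · exact ⟨0, le_rfl, fun K _ => by simp [Lagr, hys]⟩
  have hgs_proper : EProper gs := ⟨⟨ystar, hys⟩, hgs_bot⟩
  have hxs : f xstar ≠ ⊤ := by
    intro h
    obtain ⟨z, hz⟩ := hf₁.1
    have h' := hkkt₁ z
    rw [h, EReal.top_add_coe, top_le_iff] at h'
    exact hz h'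
  obtain ⟨a, ha⟩ := hf₁.exists_real hxs
  obtain ⟨b, hb⟩ := hgs_proper.exists_real hys
  choose φ hφ using fun k => hf₁.exists_real ((hx k).ne_top hxs)
  choose ψ hψ using fun k => hgs_proper.exists_real ((hy k).ne_top hys)
  have prox_x : ∀ (k : ℕ) (z : 𝓗) (r : ℝ), f z = r →
      φ k + τ⁻¹ * ⟪x k - x (k + 1), z - x (k + 1)⟫ - ⟪y k, L (z - x (k + 1))⟫ ≤ r := by
    intro k z r hz
    have h := (hx k).add_inner_le hτ hf₂ (hφ k) hz
    rwa [sub_right_comm, inner_sub_left, real_inner_smul_left,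
      ContinuousLinearMap.adjoint_inner_left, mul_sub, inv_mul_cancel_left₀ hτ.ne',
      ← add_sub_assoc] at h
  have prox_y : ∀ k : ℕ, ψ k + σ⁻¹ * ⟪y k - y (k + 1), ystar - y (k + 1)⟫
      + ⟪L (x (k + 1) + θ • (x (k + 1) - x k)), ystar - y (k + 1)⟫ ≤ b := by
    intro k
    have h := (hy k).add_inner_le hσ hgs_conv (hψ k) hb
    rwa [add_sub_right_comm, inner_add_left, real_inner_smul_left, mul_add,
      inv_mul_cancel_left₀ hσ.ne', ← add_assoc] at h
  set c : ℕ → ℝ := fun k => φ k - a + ⟪ystar, L (x (k + 1) - xstar)⟫ with hc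
  set d : ℕ → ℝ := fun k => ψ k - b - ⟪L xstar, y (k + 1) - ystar⟫ with hd
  have hc_nonneg : ∀ k, 0 ≤ c k := by
    intro k
    have h := hkkt₁ (x (k + 1))
    rw [ha, hφ, inner_neg_left, ContinuousLinearMap.adjoint_inner_left] at h
    norm_cast at h
    simp only [hc]
    linarith
  have hLv := stepsize_mul_norm_map_sq_le (L := L) hτ hσ hθ hstep
  set V : ℕ → ℝ := fun k =>
    lyapunov L τ σ θ (c k) (x k - xstar) (x (k + 1) - xstar) (y k - ystar) with hV
  have hV_nonneg : ∀ k, 0 ≤ V k := fun k => lyapunov_nonneg hτ hσ hθ hLv (hc_nonneg k) _ _ _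
  have hdescent : ∀ k, V (k + 1) + (c k + d k) ≤ V k := by
    intro k
    have h₂ := prox_x (k + 1) xstar a ha
    have h₂₁ := prox_x (k + 1) (x (k + 1)) (φ k) (hφ k)
    have h₁₂ := prox_x k (x (k + 2)) (φ (k + 1)) (hφ (k + 1))
    have h₁ := prox_y k
    refine lyapunov_add_le hσ hθ hLv ?_ ?_ ?_ ?_ <;>
      simp only [hc, hd, sub_sub_sub_cancel_right, neg_sub, map_sub, map_add, inner_sub_left,
        inner_add_left, inner_sub_right] at * <;> linarith
  have hsum : ∀ K : ℕ, ∑ k ∈ Finset.range K, (c k + d k) + V K ≤ V 0 := by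
    intro K
    induction K with
    | zero => simp
    | succ K ih => rw [Finset.sum_range_succ]; linarith [hdescent K]
  refine ⟨V 0, hV_nonneg 0, fun K hK => ?_⟩
  have hK' : (K : ℝ) ≠ 0 := by positivity
  have hX := hf₂.map_average_le hφ hK
  have hY := hgs_conv.map_average_le hψ hK
  obtain ⟨s, hs⟩ := hf₁.exists_real (hX.trans_lt (EReal.coe_lt_top _)).ne
  obtain ⟨t, ht⟩ := hgs_proper.exists_real (hY.trans_lt (EReal.coe_lt_top _)).ne
  rw [hs, EReal.coe_le_coe_iff] at hX
  rw [ht, EReal.coe_le_coe_iff] at hY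
  have hmean : (K : ℝ)⁻¹ * ∑ k ∈ Finset.range K, (c k + d k)
      = (K : ℝ)⁻¹ * ∑ k ∈ Finset.range K, φ k + (K : ℝ)⁻¹ * ∑ k ∈ Finset.range K, ψ k - a - b
        + ⟪ystar, L ((K : ℝ)⁻¹ • ∑ k ∈ Finset.range K, x (k + 1))⟫
        - ⟪(K : ℝ)⁻¹ • ∑ k ∈ Finset.range K, y (k + 1), L xstar⟫ := by
    simp only [hc, hd, map_sub, map_smul, map_sum, inner_sub_right,
      real_inner_smul_right, inner_sum, Finset.sum_add_distrib, Finset.sum_sub_distrib,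
      Finset.sum_const, Finset.card_range, nsmul_eq_mul, real_inner_comm (L xstar)]
    field_simp
    ring
  have hbound : (K : ℝ)⁻¹ * ∑ k ∈ Finset.range K, (c k + d k) ≤ V 0 / K := by
    rw [div_eq_inv_mul]
    gcongr
    linarith [hsum K, hV_nonneg K]
  unfold Lagr
  rw [hs, ht, ha, hb]
  norm_cast
  linarith
end
end

section
/- Let (x_k), (y_k) be generated by the Chambolle–Pock iteration x_{k+1} = prox_{τf}(x_k − τ L* y_k), y_{k+1} = prox_{σ g*}(y_k + σ L(x_{k+1} + θ(x_{k+1} − x_k))), with θ > 1/2 and τ, σ > 0 satisfying τσ‖L‖² < 4/(1 + 2θ), and suppose a KKT point exists (a pair (x⋆, y⋆) with −L*y⋆ ∈ ∂f(x⋆) and Lx⋆ ∈ ∂g*(y⋆)). Then the sequences (x_k) and (y_k) are bounded, and ‖x_{k+1} − x_k‖ → 0 and ‖y_{k+1} − y_k‖ → 0 as k → ∞. -/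
open scoped RealInnerProductSpace
open Filter Topology

noncomputable section

section ExtendedReal

variable {E : Type*} [NormedAddCommGroup E] [InnerProductSpace ℝ E]

/-- Convexity of an extended-real-valued function tested on real upper bounds of its values. -/
def RealConvex (f : E → EReal) : Prop :=
  ∀ x y : E, ∀ a b u v : ℝ, 0 ≤ a → 0 ≤ b → a + b = 1 → f x ≤ (u : EReal) → f y ≤ (v : EReal) →
    f (a • x + b • y) ≤ ((a * u + b * v : ℝ) : EReal)

lemma EConvex.realConvex {f : E → EReal} (hf : EConvex f) : RealConvex f := by
  intro x y a b u v ha hb hab hu hv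
  refine (hf x y a b ha hb hab).trans ?_
  rw [EReal.coe_add, EReal.coe_mul, EReal.coe_mul]
  exact add_le_add (mul_le_mul_of_nonneg_left hu (EReal.coe_nonneg.2 ha))
    (mul_le_mul_of_nonneg_left hv (EReal.coe_nonneg.2 hb))

lemma EConj_le_coe_iff {g : E → EReal} (hg : EProper g) (y : E) (u : ℝ) :
    EConj g y ≤ (u : EReal) ↔ ∀ z : E, ∀ r : ℝ, g z = (r : EReal) → ⟪z, y⟫ - r ≤ u := by
  rw [EConj, iSup_le_iff]
  refine forall_congr' fun z => ?_
  constructor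
  · intro h r hr
    rw [hr] at h
    exact_mod_cast h
  · intro h
    rcases eq_or_ne (g z) ⊤ with ht | ht
    · simp [ht]
    · obtain ⟨r, hr⟩ : ∃ r : ℝ, g z = (r : EReal) :=
        ⟨(g z).toReal, (EReal.coe_toReal ht (hg.2 z)).symm⟩
      rw [hr]
      exact_mod_cast h r hr

lemma realConvex_EConj {g : E → EReal} (hg : EProper g) : RealConvex (EConj g) := by
  intro x y a b u v ha hb hab hu hv
  rw [EConj_le_coe_iff hg] at hu hv ⊢
  intro z r hr
  have h1 := mul_le_mul_of_nonneg_left (hu z r hr) ha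
  have h2 := mul_le_mul_of_nonneg_left (hv z r hr) hb
  have h3 : r = a * r + b * r := by rw [← add_mul, hab, one_mul]
  rw [inner_add_right, inner_smul_right, inner_smul_right]
  linarith

/-- A proper convex lower semicontinuous function has an affine minorant. -/
lemma exists_affine_minorant [CompleteSpace E] {g : E → EReal} (hg₁ : EProper g) (hg₂ : EConvex g)
    (hg₃ : LowerSemicontinuous g) :
    ∃ (v : E) (c : ℝ), ∀ z : E, ∀ r : ℝ, g z = (r : EReal) → ⟪z, v⟫ + c ≤ r := by
  let S : Set (E × ℝ) := {p | g p.1 ≤ (p.2 : EReal)}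
  have hclosed : IsClosed S := hg₃.isClosed_epigraph.preimage
    (continuous_fst.prodMk (continuous_coe_real_ereal.comp continuous_snd))
  have hconv : Convex ℝ S := fun p hp q hq a b ha hb hab =>
    hg₂.realConvex p.1 q.1 a b p.2 q.2 ha hb hab hp hq
  obtain ⟨z₀, hz₀⟩ := hg₁.1
  obtain ⟨r₀, hr₀⟩ : ∃ r : ℝ, g z₀ = (r : EReal) :=
    ⟨(g z₀).toReal, (EReal.coe_toReal hz₀ (hg₁.2 z₀)).symm⟩
  have hnot : (z₀, r₀ - 1) ∉ S := by
    intro h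
    have h' : g z₀ ≤ ((r₀ - 1 : ℝ) : EReal) := h
    rw [hr₀, EReal.coe_le_coe_iff] at h'
    linarith
  obtain ⟨φ, u, hu, hS⟩ := geometric_hahn_banach_point_closed hconv hclosed hnot
  have hsplit : ∀ z t, φ (z, t) = φ (z, 0) + t * φ (0, 1) := by
    intro z t
    have : ((z, t) : E × ℝ) = (z, 0) + t • ((0, 1) : E × ℝ) := by simp
    rw [this, map_add, map_smul, smul_eq_mul]
  have hmem : ∀ z r, g z = ((r : ℝ) : EReal) → u < φ (z, 0) + r * φ (0, 1) := by
    intro z r hr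
    rw [← hsplit]
    exact hS (z, r) hr.le
  rw [hsplit] at hu
  have hc : 0 < φ (0, 1) := by
    have := hmem z₀ r₀ hr₀
    linarith
  let ψ : E →L[ℝ] ℝ := φ.comp (ContinuousLinearMap.inl ℝ E ℝ)
  have hψ : ∀ z, ⟪z, (InnerProductSpace.toDual ℝ E).symm ψ⟫ = φ (z, 0) := by
    intro z
    rw [real_inner_comm, InnerProductSpace.toDual_symm_apply]
    rfl
  refine ⟨(-(φ (0, 1))⁻¹) • (InnerProductSpace.toDual ℝ E).symm ψ, u / φ (0, 1), ?_⟩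
  intro z r hr
  rw [inner_smul_right, hψ]
  have h := hmem z r hr
  have h' : -(φ (0, 1))⁻¹ * φ (z, 0) + u / φ (0, 1) = (u - φ (z, 0)) / φ (0, 1) := by
    field_simp
    ring
  rw [h', div_le_iff₀ hc]
  linarith

lemma EProper.conj [CompleteSpace E] {g : E → EReal} (hg₁ : EProper g) (hg₂ : EConvex g)
    (hg₃ : LowerSemicontinuous g) : EProper (EConj g) := by
  constructor
  · obtain ⟨v, c, hv⟩ := exists_affine_minorant hg₁ hg₂ hg₃
    refine ⟨v, ne_top_of_le_ne_top (EReal.coe_ne_top (-c)) ?_⟩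
    rw [EConj_le_coe_iff hg₁]
    intro z r hr
    linarith [hv z r hr]
  · intro y hy
    obtain ⟨z, hz⟩ := hg₁.1
    have h : EConj g y ≤ ((⟪z, y⟫ - (g z).toReal - 1 : ℝ) : EReal) := by rw [hy]; exact bot_le
    rw [EConj_le_coe_iff hg₁] at h
    have := h z _ (EReal.coe_toReal hz (hg₁.2 z)).symm
    linarith

lemma EProper.ne_top_of_mem_ESubdiff {f : E → EReal} (hf : EProper f) {x u : E}
    (hu : u ∈ ESubdiff f x) : f x ≠ ⊤ := by
  obtain ⟨z, hz⟩ := hf.1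
  intro h
  have := hu z
  rw [h, EReal.top_add_coe, top_le_iff] at this
  exact hz this

lemma EProper.ne_top_of_isProx {f : E → EReal} (hf : EProper f) {τ : ℝ} {x p : E}
    (hp : IsProx τ f x p) : f p ≠ ⊤ := by
  obtain ⟨z, hz⟩ := hf.1
  intro h
  have := hp z
  rw [h, EReal.top_add_coe, top_le_iff] at this
  exact (EReal.add_lt_top hz (EReal.coe_ne_top _)).ne this

/-- If `p = prox_{τ f}(x)`, then `(x - p) / τ` is a subgradient of `f` at `p`. -/
lemma IsProx.subgradient_le {f : E → EReal} (hf : RealConvex f) {τ : ℝ} {x p : E} (hp : IsProx τ f x p)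
    {z : E} {a b : ℝ} (ha : f p = (a : EReal)) (hb : f z = (b : EReal)) :
    a + τ⁻¹ * ⟪x - p, z - p⟫ ≤ b := by
  have key : ∀ t : ℝ, 0 < t → t < 1 →
      a + τ⁻¹ * ⟪x - p, z - p⟫ ≤ b + t * (1 / (2 * τ) * ‖z - p‖ ^ 2) := by
    intro t ht0 ht1
    have h1 := hf p z (1 - t) t a b (by linarith) ht0.le (by ring) ha.le hb.le
    have h2 : ((a + 1 / (2 * τ) * ‖p - x‖ ^ 2 : ℝ) : EReal) ≤
        (((1 - t) * a + t * b + 1 / (2 * τ) * ‖(1 - t) • p + t • z - x‖ ^ 2 : ℝ) : EReal) := by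
      have h3 := hp ((1 - t) • p + t • z)
      rw [ha, ← EReal.coe_add] at h3
      rw [EReal.coe_add _ (1 / (2 * τ) * ‖(1 - t) • p + t • z - x‖ ^ 2)]
      exact h3.trans (add_le_add_left h1 _)
    rw [EReal.coe_le_coe_iff] at h2
    have h4 : (1 - t) • p + t • z - x = -(x - p) + t • (z - p) := by module
    have h5 : ‖p - x‖ = ‖x - p‖ := norm_sub_rev _ _
    rw [h4, norm_add_sq_real, norm_neg, norm_smul, inner_neg_left, inner_smul_right, mul_pow,
      Real.norm_eq_abs, sq_abs, h5] at h2
    have h6 : (1 : ℝ) / (2 * τ) = τ⁻¹ / 2 := by rw [one_div, mul_inv]; ring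
    rw [h6] at h2 ⊢
    refine le_of_mul_le_mul_left ?_ ht0
    linarith
  have hlim : Tendsto (fun t : ℝ => b + t * (1 / (2 * τ) * ‖z - p‖ ^ 2)) (𝓝[>] 0) (𝓝 b) := by
    have : Continuous fun t : ℝ => b + t * (1 / (2 * τ) * ‖z - p‖ ^ 2) := by fun_prop
    simpa using (this.tendsto 0).mono_left nhdsWithin_le_nhds
  refine ge_of_tendsto hlim ?_
  filter_upwards [Ioo_mem_nhdsGT (zero_lt_one' ℝ)] with t ht
  exact key t ht.1 ht.2

lemma ESubdiff.real_le {f : E → EReal} {x u z : E} (hu : u ∈ ESubdiff f x) {a b : ℝ}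
    (ha : f x = (a : EReal)) (hb : f z = (b : EReal)) : a + ⟪u, z - x⟫ ≤ b := by
  have := hu z
  rw [ha, hb] at this
  exact_mod_cast this

end ExtendedReal

section Lyapunov

variable {H K : Type*} [NormedAddCommGroup H] [InnerProductSpace ℝ H] [CompleteSpace H]
  [NormedAddCommGroup K] [InnerProductSpace ℝ K] [CompleteSpace K]

/-- The Lyapunov function of the Chambolle–Pock iteration: `x`, `y` are the current iterates
relative to a KKT point, `p`, `q` the last increments, and `F` the primal Bregman gap. -/
def cpLyapunov (L : H →L[ℝ] K) (τ σ θ : ℝ) (x p : H) (y q : K) (F : ℝ) : ℝ :=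
  τ⁻¹ / 2 * ‖x‖ ^ 2 + σ⁻¹ / 2 * ‖y‖ ^ 2 - ⟪L x, y⟫ + (θ - 1) * F
    + τ⁻¹ / 4 * ‖p - τ • ContinuousLinearMap.adjoint L q‖ ^ 2

lemma inv_mul_norm_sub_smul_adjoint_sq (L : H →L[ℝ] K) {τ : ℝ} (hτ : 0 < τ) (c : ℝ) (p : H) (q : K) :
    τ⁻¹ * ‖p - (c * τ) • ContinuousLinearMap.adjoint L q‖ ^ 2
      = τ⁻¹ * ‖p‖ ^ 2 - 2 * c * ⟪L p, q⟫ + c ^ 2 * τ * ‖ContinuousLinearMap.adjoint L q‖ ^ 2 := by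
  rw [norm_sub_sq_real, norm_smul, inner_smul_right, ContinuousLinearMap.adjoint_inner_right,
    mul_pow, Real.norm_eq_abs, sq_abs]
  field_simp

lemma norm_adjoint_apply_sq_le (L : H →L[ℝ] K) (q : K) :
    ‖ContinuousLinearMap.adjoint L q‖ ^ 2 ≤ ‖L‖ ^ 2 * ‖q‖ ^ 2 := by
  rw [← mul_pow]
  have := (ContinuousLinearMap.adjoint L).le_opNorm q
  rw [LinearIsometryEquiv.norm_map] at this
  gcongr

lemma cpLyapunov_descent (L : H →L[ℝ] K) {τ σ θ : ℝ} (hτ : 0 < τ) (hθ : 1 / 2 < θ)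
    {x₀ x₁ x₂ : H} {y₀ y₁ y₂ : K} {F₁ F₂ G₂ : ℝ} (hF : 0 ≤ F₂) (hG : 0 ≤ G₂)
    (hA : F₂ + τ⁻¹ * ⟪x₂ - x₁, x₂⟫ + ⟪L x₂, y₁⟫ ≤ 0)
    (hB : G₂ + σ⁻¹ * ⟪y₂ - y₁, y₂⟫ - ⟪L x₂, y₂⟫ - θ * ⟪L (x₂ - x₁), y₂⟫ ≤ 0)
    (hC : F₂ + τ⁻¹ * ‖x₂ - x₁‖ ^ 2 + ⟪L (x₂ - x₁), y₁⟫ ≤ F₁)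
    (hD : F₁ - τ⁻¹ * ⟪x₁ - x₀, x₂ - x₁⟫ - ⟪L (x₂ - x₁), y₀⟫ ≤ F₂) :
    cpLyapunov L τ σ θ x₂ (x₂ - x₁) y₂ (y₂ - y₁) F₂
      + ((θ - 1 / 2) * τ⁻¹ * ‖(x₂ - x₁) - (1 / 2 * τ) • ContinuousLinearMap.adjoint L (y₂ - y₁)‖ ^ 2
        + (σ⁻¹ / 2 - (θ + 1 / 2) / 4 * τ * ‖L‖ ^ 2) * ‖y₂ - y₁‖ ^ 2)
      ≤ cpLyapunov L τ σ θ x₁ (x₁ - x₀) y₁ (y₁ - y₀) F₁ := by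
  obtain ⟨p, rfl⟩ : ∃ p, x₂ = x₁ + p := ⟨x₂ - x₁, by abel⟩
  obtain ⟨q, rfl⟩ : ∃ q, y₂ = y₁ + q := ⟨y₂ - y₁, by abel⟩
  obtain ⟨p', rfl⟩ : ∃ p', x₀ = x₁ - p' := ⟨x₁ - x₀, by abel⟩
  obtain ⟨q', rfl⟩ : ∃ q', y₀ = y₁ - q' := ⟨y₁ - y₀, by abel⟩
  simp only [add_sub_cancel_left, sub_sub_cancel] at *
  have hC' := mul_le_mul_of_nonneg_left hC (sub_nonneg.2 hθ.le)
  have hr := mul_le_mul_of_nonneg_left (norm_adjoint_apply_sq_le L q)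
    (show 0 ≤ (θ + 1 / 2) / 4 * τ by positivity)
  have e1 := inv_mul_norm_sub_smul_adjoint_sq L hτ 1 p q
  have e2 := congrArg (fun t => (θ - 1 / 2) * t) (inv_mul_norm_sub_smul_adjoint_sq L hτ (1 / 2) p q)
  -- the square left over by the memory term
  have e3 : 0 ≤ τ⁻¹ * ‖p - (p' - τ • ContinuousLinearMap.adjoint L q')‖ ^ 2 := by positivity
  have e4 : τ⁻¹ * ‖p - (p' - τ • ContinuousLinearMap.adjoint L q')‖ ^ 2 = τ⁻¹ * ‖p‖ ^ 2
      - 2 * (τ⁻¹ * ⟪p', p⟫) + 2 * ⟪L p, q'⟫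
      + τ⁻¹ * ‖p' - τ • ContinuousLinearMap.adjoint L q'‖ ^ 2 := by
    rw [norm_sub_sq_real p, inner_sub_right, inner_smul_right,
      ContinuousLinearMap.adjoint_inner_right, real_inner_comm]
    field_simp
    ring
  simp only [one_mul] at e1
  simp only [cpLyapunov, norm_add_sq_real, map_add, inner_add_left, inner_add_right,
    inner_sub_right, real_inner_self_eq_norm_sq, real_inner_comm x₁,
    real_inner_comm y₁] at *
  linarith

lemma le_cpLyapunov (L : H →L[ℝ] K) {τ σ θ : ℝ} (hτ : 0 < τ) (hθ : 1 / 2 < θ)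
    {x₀ x₁ : H} {y₀ y₁ : K} {F₁ : ℝ} (hF : 0 ≤ F₁)
    (hA : F₁ + τ⁻¹ * ⟪x₁ - x₀, x₁⟫ + ⟪L x₁, y₀⟫ ≤ 0) :
    τ⁻¹ / 4 * ‖x₁ - τ • ContinuousLinearMap.adjoint L y₁‖ ^ 2
      + (σ⁻¹ / 2 - (θ + 1 / 2) / 4 * τ * ‖L‖ ^ 2) * ‖y₁‖ ^ 2
      ≤ cpLyapunov L τ σ θ x₁ (x₁ - x₀) y₁ (y₁ - y₀) F₁ := by
  obtain ⟨p, rfl⟩ : ∃ p, x₀ = x₁ - p := ⟨x₁ - x₀, by abel⟩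
  obtain ⟨q, rfl⟩ : ∃ q, y₀ = y₁ - q := ⟨y₁ - y₀, by abel⟩
  simp only [sub_sub_cancel] at *
  have hr := mul_le_mul_of_nonneg_left (norm_adjoint_apply_sq_le L y₁)
    (show 0 ≤ τ / 4 by positivity)
  have hθ' : 0 ≤ (θ - 1 / 2) * (τ * (‖L‖ ^ 2 * ‖y₁‖ ^ 2)) :=
    mul_nonneg (by linarith) (by positivity)
  have hF' : 0 ≤ (θ - 1 / 2) * F₁ := mul_nonneg (by linarith) hF
  have e1 := inv_mul_norm_sub_smul_adjoint_sq L hτ 1 x₁ y₁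
  simp only [one_mul] at e1
  have e3 : 0 ≤ τ⁻¹ * ‖x₁ + (p - τ • ContinuousLinearMap.adjoint L q)‖ ^ 2 := by positivity
  have e4 : τ⁻¹ * ‖x₁ + (p - τ • ContinuousLinearMap.adjoint L q)‖ ^ 2 = τ⁻¹ * ‖x₁‖ ^ 2
      + 2 * (τ⁻¹ * ⟪p, x₁⟫) - 2 * ⟪L x₁, q⟫
      + τ⁻¹ * ‖p - τ • ContinuousLinearMap.adjoint L q‖ ^ 2 := by
    rw [norm_add_sq_real x₁, inner_sub_right, inner_smul_right,
      ContinuousLinearMap.adjoint_inner_right, real_inner_comm]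
    field_simp
    ring
  simp only [cpLyapunov, inner_sub_right] at *
  linarith

end Lyapunov

lemma tendsto_zero_of_add_le {V R : ℕ → ℝ} (hV : ∀ k, 0 ≤ V k) (hR : ∀ k, 0 ≤ R k)
    (h : ∀ k, V (k + 1) + R k ≤ V k) : Tendsto R atTop (𝓝 0) := by
  have hanti : Antitone V := antitone_nat_of_succ_le fun k => by linarith [h k, hR k]
  have hlim := tendsto_atTop_ciInf hanti ⟨0, by rintro _ ⟨k, rfl⟩; exact hV k⟩
  have hdiff := hlim.sub (hlim.comp (tendsto_add_atTop_nat 1))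
  rw [sub_self] at hdiff
  exact squeeze_zero hR (fun k => by have := h k; simp only [Function.comp]; linarith) hdiff

lemma tendsto_norm_zero_of_mul_sq {E : Type*} [NormedAddCommGroup E] {u : ℕ → E} {R : ℕ → ℝ} {c : ℝ}
    (hc : 0 < c) (hR : Tendsto R atTop (𝓝 0)) (h : ∀ k, c * ‖u k‖ ^ 2 ≤ R k) :
    Tendsto (fun k => ‖u k‖) atTop (𝓝 0) := by
  have h1 : Tendsto (fun k => ‖u k‖ ^ 2) atTop (𝓝 0) := by
    refine squeeze_zero (fun k => by positivity) (fun k => ?_) (g := fun k => R k / c) ?_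
    · rw [le_div_iff₀ hc, mul_comm]; exact h k
    · simpa using hR.div_const c
  simpa using h1.sqrt

lemma exists_norm_le_of_mul_sq {E : Type*} [NormedAddCommGroup E] {u : ℕ → E} {c M : ℝ}
    (hc : 0 < c) (h : ∀ k, c * ‖u k‖ ^ 2 ≤ M) : ∃ B, ∀ k, ‖u k‖ ≤ B := by
  refine ⟨√(M / c), fun k => Real.le_sqrt_of_sq_le ?_⟩
  rw [le_div_iff₀ hc, mul_comm]
  exact h k

lemma exists_norm_le_of_succ {E : Type*} [NormedAddCommGroup E] {u : ℕ → E} {c : E} {B : ℝ}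
    (h : ∀ k, ‖u (k + 1) - c‖ ≤ B) : ∃ M, ∀ k, ‖u k‖ ≤ M := by
  refine ⟨max ‖u 0‖ (B + ‖c‖), fun k => ?_⟩
  cases k with
  | zero => exact le_max_left _ _
  | succ k =>
    refine le_max_of_le_right ?_
    have h1 := norm_add_le (u (k + 1) - c) c
    rw [sub_add_cancel] at h1
    linarith [h k]

theorem bounded_and_residuals_vanish
    {𝓗 𝓖 : Type*}
    [NormedAddCommGroup 𝓗] [InnerProductSpace ℝ 𝓗] [CompleteSpace 𝓗]
    [NormedAddCommGroup 𝓖] [InnerProductSpace ℝ 𝓖] [CompleteSpace 𝓖]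
    (f : 𝓗 → EReal) (g : 𝓖 → EReal) (gs : 𝓖 → EReal)
    (hf₁ : EProper f) (hf₂ : EConvex f) (hf₃ : LowerSemicontinuous f)
    (hg₁ : EProper g) (hg₂ : EConvex g) (hg₃ : LowerSemicontinuous g)
    (hgs : gs = EConj g)
    (L : 𝓗 →L[ℝ] 𝓖) (hL : L ≠ 0)
    (τ σ θ : ℝ) (hτ : 0 < τ) (hσ : 0 < σ)
    (hθ : 1 / 2 < θ) (hstep : τ * σ * ‖L‖ ^ 2 < 4 / (1 + 2 * θ))
    (hexist : ∃ (xstar : 𝓗) (ystar : 𝓖),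
      -((ContinuousLinearMap.adjoint L) ystar) ∈ ESubdiff f xstar ∧
        L xstar ∈ ESubdiff gs ystar)
    (x : ℕ → 𝓗) (y : ℕ → 𝓖)
    (hx : ∀ k : ℕ, IsProx τ f (x k - τ • (ContinuousLinearMap.adjoint L) (y k)) (x (k + 1)))
    (hy : ∀ k : ℕ,
      IsProx σ gs (y k + σ • L (x (k + 1) + θ • (x (k + 1) - x k))) (y (k + 1)))
    :
    (∃ M : ℝ, ∀ k : ℕ, ‖x k‖ ≤ M) ∧ (∃ M : ℝ, ∀ k : ℕ, ‖y k‖ ≤ M) ∧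
    Tendsto (fun k => ‖x (k + 1) - x k‖) atTop (𝓝 0) ∧
    Tendsto (fun k => ‖y (k + 1) - y k‖) atTop (𝓝 0) := by
  obtain ⟨xs, ys, hxs, hys⟩ := hexist
  have hgs₁ : EProper gs := hgs ▸ hg₁.conj hg₂ hg₃
  have hgs₂ : RealConvex gs := hgs ▸ realConvex_EConj hg₁
  have hf₂' := hf₂.realConvex
  have hfx : ∀ k, f (x (k + 1)) = ((f (x (k + 1))).toReal : EReal) := fun k =>
    (EReal.coe_toReal (hf₁.ne_top_of_isProx (hx k)) (hf₁.2 _)).symm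
  have hgy : ∀ k, gs (y (k + 1)) = ((gs (y (k + 1))).toReal : EReal) := fun k =>
    (EReal.coe_toReal (hgs₁.ne_top_of_isProx (hy k)) (hgs₁.2 _)).symm
  have hfs : f xs = ((f xs).toReal : EReal) :=
    (EReal.coe_toReal (hf₁.ne_top_of_mem_ESubdiff hxs) (hf₁.2 _)).symm
  have hgss : gs ys = ((gs ys).toReal : EReal) :=
    (EReal.coe_toReal (hgs₁.ne_top_of_mem_ESubdiff hys) (hgs₁.2 _)).symm
  -- primal and dual Bregman gaps with respect to the KKT point
  obtain ⟨F, hFdef⟩ : ∃ F : ℕ → ℝ, ∀ k,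
      F k = (f (x (k + 1))).toReal - (f xs).toReal + ⟪L (x (k + 1) - xs), ys⟫ := ⟨_, fun _ => rfl⟩
  obtain ⟨G, hGdef⟩ : ∃ G : ℕ → ℝ, ∀ k,
      G k = (gs (y (k + 1))).toReal - (gs ys).toReal - ⟪L xs, y (k + 1) - ys⟫ := ⟨_, fun _ => rfl⟩
  have hF : ∀ k, 0 ≤ F k := by
    intro k
    have h := ESubdiff.real_le hxs hfs (hfx k)
    rw [inner_neg_left, ContinuousLinearMap.adjoint_inner_left, real_inner_comm] at h
    rw [hFdef]
    linarith
  have hG : ∀ k, 0 ≤ G k := by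
    intro k
    have h := ESubdiff.real_le hys hgss (hgy k)
    rw [hGdef]
    linarith
  have hTτ : τ⁻¹ * τ = 1 := inv_mul_cancel₀ hτ.ne'
  have hSσ : σ⁻¹ * σ = 1 := inv_mul_cancel₀ hσ.ne'
  have hprimal : ∀ (k : ℕ) (z : 𝓗) (b : ℝ), f z = (b : EReal) →
      (f (x (k + 1))).toReal - τ⁻¹ * ⟪x (k + 1) - x k, z - x (k + 1)⟫
        - ⟪L (z - x (k + 1)), y k⟫ ≤ b := by
    intro k z b hb
    have h := (hx k).subgradient_le hf₂' (hfx k) hb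
    rw [show x k - τ • (ContinuousLinearMap.adjoint L) (y k) - x (k + 1)
      = -(x (k + 1) - x k) - τ • (ContinuousLinearMap.adjoint L) (y k) by abel, inner_sub_left,
      inner_neg_left, inner_smul_left, ContinuousLinearMap.adjoint_inner_left,
      real_inner_comm (L (z - x (k + 1))) (y k), mul_sub, RCLike.conj_to_real, ← mul_assoc,
      hTτ] at h
    linarith
  have hdual : ∀ (k : ℕ) (z : 𝓖) (b : ℝ), gs z = (b : EReal) →
      (gs (y (k + 1))).toReal - σ⁻¹ * ⟪y (k + 1) - y k, z - y (k + 1)⟫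
        + ⟪L (x (k + 1) + θ • (x (k + 1) - x k)), z - y (k + 1)⟫ ≤ b := by
    intro k z b hb
    have h := (hy k).subgradient_le hgs₂ (hgy k) hb
    rw [show y k + σ • L (x (k + 1) + θ • (x (k + 1) - x k)) - y (k + 1)
      = -(y (k + 1) - y k) + σ • L (x (k + 1) + θ • (x (k + 1) - x k)) by abel, inner_add_left,
      inner_neg_left, inner_smul_left, mul_add, RCLike.conj_to_real, ← mul_assoc, hSσ] at h
    linarith
  have hA : ∀ k, F k + τ⁻¹ * ⟪(x (k + 1) - xs) - (x k - xs), x (k + 1) - xs⟫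
      + ⟪L (x (k + 1) - xs), y k - ys⟫ ≤ 0 := by
    intro k
    have h := hprimal k xs _ hfs
    rw [← neg_sub (x (k + 1)) xs, inner_neg_right, map_neg, inner_neg_left] at h
    rw [hFdef, sub_sub_sub_cancel_right, inner_sub_right (L _)]
    linarith
  have hB : ∀ k, G k + σ⁻¹ * ⟪(y (k + 1) - ys) - (y k - ys), y (k + 1) - ys⟫
      - ⟪L (x (k + 1) - xs), y (k + 1) - ys⟫
      - θ * ⟪L ((x (k + 1) - xs) - (x k - xs)), y (k + 1) - ys⟫ ≤ 0 := by
    intro k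
    have h := hdual k ys _ hgss
    rw [← neg_sub (y (k + 1)) ys, inner_neg_right, inner_neg_right, map_add, map_smul,
      inner_add_left, inner_smul_left, RCLike.conj_to_real] at h
    rw [hGdef, sub_sub_sub_cancel_right, sub_sub_sub_cancel_right, map_sub L _ xs,
      inner_sub_left (L _)]
    linarith
  have hC : ∀ k, F (k + 1) + τ⁻¹ * ‖(x (k + 2) - xs) - (x (k + 1) - xs)‖ ^ 2
      + ⟪L ((x (k + 2) - xs) - (x (k + 1) - xs)), y (k + 1) - ys⟫ ≤ F k := by
    intro k
    have h := hprimal (k + 1) (x (k + 1)) _ (hfx k)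
    rw [← neg_sub (x (k + 1 + 1)) (x (k + 1)), inner_neg_right, map_neg, inner_neg_left,
      real_inner_self_eq_norm_sq] at h
    rw [hFdef, hFdef, sub_sub_sub_cancel_right, inner_sub_right (L _)]
    simp only [map_sub, inner_sub_left] at *
    linarith
  have hD : ∀ k, F k - τ⁻¹ * ⟪(x (k + 1) - xs) - (x k - xs), (x (k + 2) - xs) - (x (k + 1) - xs)⟫
      - ⟪L ((x (k + 2) - xs) - (x (k + 1) - xs)), y k - ys⟫ ≤ F (k + 1) := by
    intro k
    have h := hprimal k (x (k + 2)) _ (hfx (k + 1))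
    rw [hFdef, hFdef, sub_sub_sub_cancel_right, sub_sub_sub_cancel_right, inner_sub_right (L _)]
    simp only [map_sub, inner_sub_left (L _)] at *
    linarith
  obtain ⟨V, hV⟩ : ∃ V : ℕ → ℝ, ∀ k, V k = cpLyapunov L τ σ θ (x (k + 1) - xs)
      ((x (k + 1) - xs) - (x k - xs)) (y (k + 1) - ys) ((y (k + 1) - ys) - (y k - ys)) (F k) :=
    ⟨_, fun _ => rfl⟩
  obtain ⟨D, hDdef⟩ : ∃ D : ℝ, D = σ⁻¹ / 2 - (θ + 1 / 2) / 4 * τ * ‖L‖ ^ 2 := ⟨_, rfl⟩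
  have hDpos : 0 < D := by
    rw [lt_div_iff₀ (by linarith)] at hstep
    have h : D = σ⁻¹ / 8 * (4 - τ * σ * ‖L‖ ^ 2 * (1 + 2 * θ)) := by
      rw [hDdef]
      field_simp
      ring
    rw [h]
    exact mul_pos (by positivity) (by linarith)
  have hT : 0 < τ⁻¹ := inv_pos.2 hτ
  have hθT : 0 < (θ - 1 / 2) * τ⁻¹ := mul_pos (by linarith) hT
  have hlow : ∀ k, τ⁻¹ / 4 * ‖(x (k + 1) - xs) - τ • ContinuousLinearMap.adjoint L (y (k + 1) - ys)‖ ^ 2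
      + D * ‖y (k + 1) - ys‖ ^ 2 ≤ V k := by
    intro k
    rw [hV, hDdef]
    exact le_cpLyapunov L hτ hθ (hF k) (hA k)
  obtain ⟨r, hr⟩ : ∃ r : ℕ → 𝓗, ∀ k, r k = (x (k + 2) - x (k + 1))
      - (1 / 2 * τ) • ContinuousLinearMap.adjoint L (y (k + 2) - y (k + 1)) := ⟨_, fun _ => rfl⟩
  have hdesc : ∀ k, V (k + 1) + ((θ - 1 / 2) * τ⁻¹ * ‖r k‖ ^ 2
      + D * ‖y (k + 2) - y (k + 1)‖ ^ 2) ≤ V k := by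
    intro k
    have h := cpLyapunov_descent L (σ := σ) hτ hθ (hF (k + 1)) (hG (k + 1)) (hA (k + 1)) (hB (k + 1))
      (hC k) (hD k)
    rw [← hV, ← hV, ← hDdef, sub_sub_sub_cancel_right, sub_sub_sub_cancel_right] at h
    rw [hr]
    exact h
  have hVnn : ∀ k, 0 ≤ V k := fun k => le_trans (by positivity) (hlow k)
  have hanti : Antitone V := antitone_nat_of_succ_le fun k =>
    le_trans (le_add_of_nonneg_right (by positivity)) (hdesc k)
  have hres := tendsto_zero_of_add_le hVnn (fun k => by positivity) hdesc
  have hq := tendsto_norm_zero_of_mul_sq (u := fun k => y (k + 2) - y (k + 1)) hDpos hres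
    fun k => le_add_of_nonneg_left (by positivity)
  have hrlim := tendsto_norm_zero_of_mul_sq (u := r) hθT hres
    fun k => le_add_of_nonneg_right (by positivity)
  obtain ⟨By, hBy⟩ := exists_norm_le_of_mul_sq (u := fun k => y (k + 1) - ys) hDpos
    fun k => (le_add_of_nonneg_left (by positivity)).trans ((hlow k).trans (hanti (Nat.zero_le k)))
  obtain ⟨Bx, hBx⟩ := exists_norm_le_of_mul_sq
    (u := fun k => (x (k + 1) - xs) - τ • ContinuousLinearMap.adjoint L (y (k + 1) - ys))
    (show 0 < τ⁻¹ / 4 by positivity)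
    fun k => (le_add_of_nonneg_right (by positivity)).trans ((hlow k).trans (hanti (Nat.zero_le k)))
  have hadj : ∀ (c : ℝ) (q : 𝓖), 0 ≤ c →
      ‖c • ContinuousLinearMap.adjoint L q‖ ≤ c * (‖L‖ * ‖q‖) := by
    intro c q hc
    rw [norm_smul, Real.norm_of_nonneg hc]
    have h := (ContinuousLinearMap.adjoint L).le_opNorm q
    rw [LinearIsometryEquiv.norm_map] at h
    gcongr
  refine ⟨exists_norm_le_of_succ (c := xs) (B := Bx + τ * (‖L‖ * By)) fun k => ?_,
    exists_norm_le_of_succ hBy, ?_, ?_⟩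
  · have h1 := norm_add_le ((x (k + 1) - xs) - τ • ContinuousLinearMap.adjoint L (y (k + 1) - ys))
      (τ • ContinuousLinearMap.adjoint L (y (k + 1) - ys))
    rw [sub_add_cancel] at h1
    refine h1.trans (add_le_add (hBx k) ((hadj τ _ hτ.le).trans ?_))
    gcongr
    exact hBy k
  · rw [← tendsto_add_atTop_iff_nat 1]
    refine squeeze_zero (fun k => norm_nonneg _) (fun k => ?_)
      (g := fun k => ‖r k‖ + 1 / 2 * τ * (‖L‖ * ‖y (k + 2) - y (k + 1)‖)) ?_
    · have h1 := norm_add_le (r k)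
        ((1 / 2 * τ) • ContinuousLinearMap.adjoint L (y (k + 2) - y (k + 1)))
      rw [hr, sub_add_cancel, ← hr] at h1
      exact h1.trans (add_le_add le_rfl (hadj _ _ (by positivity)))
    · simpa using hrlim.add ((hq.const_mul ‖L‖).const_mul (1 / 2 * τ))
  · rw [← tendsto_add_atTop_iff_nat 1]
    exact hq
end
end

section
/- Let (x_k), (y_k) be generated by the Chambolle–Pock iteration x_{k+1} = prox_{τf}(x_k − τ L* y_k), y_{k+1} = prox_{σ g*}(y_k + σ L(x_{k+1} + θ(x_{k+1} − x_k))), with θ > 1/2 and τ, σ > 0 satisfying the boundary condition τσ‖L‖² = 4/(1 + 2θ), and suppose a KKT point exists (a pair (x⋆, y⋆) with −L*y⋆ ∈ ∂f(x⋆) and Lx⋆ ∈ ∂g*(y⋆)). Then the series ∑_{k=0}^{∞} ‖x_{k+2} − x_k‖² converges; in particular, ‖x_{k+2} − x_k‖ → 0 as k → ∞, i.e. the difference between every second iterate converges to zero. -/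
open scoped RealInnerProductSpace
open Filter Topology

noncomputable section

/-- Epigraphical form of convexity, free of `EReal` arithmetic. -/
def EpiConvex {E : Type*} [NormedAddCommGroup E] [NormedSpace ℝ E] (f : E → EReal) : Prop :=
  ∀ x y : E, ∀ a b r s : ℝ, 0 ≤ a → 0 ≤ b → a + b = 1 → f x ≤ (r : EReal) → f y ≤ (s : EReal) →
    f (a • x + b • y) ≤ ((a * r + b * s : ℝ) : EReal)

theorem EConvex.epiConvex {E : Type*} [NormedAddCommGroup E] [NormedSpace ℝ E] {f : E → EReal}
    (hf : EConvex f) : EpiConvex f := by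
  intro x y a b r s ha hb hab hx hy
  refine (hf x y a b ha hb hab).trans ?_
  rw [EReal.coe_add, EReal.coe_mul, EReal.coe_mul]
  exact add_le_add (mul_le_mul_of_nonneg_left hx (by exact_mod_cast ha))
    (mul_le_mul_of_nonneg_left hy (by exact_mod_cast hb))

section Conjugate

variable {E : Type*} [NormedAddCommGroup E] [InnerProductSpace ℝ E] {g : E → EReal}

theorem econj_le_coe_iff (hg : ∀ x, g x ≠ ⊥) {y : E} {r : ℝ} :
    EConj g y ≤ (r : EReal) ↔ ∀ x : E, ∀ s : ℝ, g x = (s : EReal) → ⟪x, y⟫ - s ≤ r := by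
  rw [EConj, iSup_le_iff]
  refine forall_congr' fun x => ?_
  induction h : g x with
  | bot => exact absurd h (hg x)
  | top => simp
  | coe t =>
    rw [← EReal.coe_sub, EReal.coe_le_coe_iff]
    simp

theorem epiConvex_econj (hg : ∀ x, g x ≠ ⊥) : EpiConvex (EConj g) := by
  intro y z a b r s ha hb hab hy hz
  rw [econj_le_coe_iff hg] at hy hz ⊢
  intro x t hx
  have h₁ := mul_le_mul_of_nonneg_left (hy x t hx) ha
  have h₂ := mul_le_mul_of_nonneg_left (hz x t hx) hb
  have h₃ : t = a * t + b * t := by rw [← add_mul, hab, one_mul]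
  rw [inner_add_right, real_inner_smul_right, real_inner_smul_right]
  linarith

theorem econj_ne_bot (hg : EProper g) (y : E) : EConj g y ≠ ⊥ := by
  obtain ⟨⟨x, hx⟩, hbot⟩ := hg
  intro h
  have h₁ : EConj g y ≤ ((⟪x, y⟫ - (g x).toReal - 1 : ℝ) : EReal) := h ▸ bot_le
  have := (econj_le_coe_iff hbot).1 h₁ x _ (EReal.coe_toReal hx (hbot x)).symm
  linarith

theorem exists_econj_ne_top [CompleteSpace E] (hg : EProper g) (hconv : EConvex g)
    (hlsc : LowerSemicontinuous g) : ∃ y, EConj g y ≠ ⊤ := by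
  obtain ⟨⟨x₀, hx₀⟩, hbot⟩ := hg
  lift g x₀ to ℝ using ⟨hx₀, hbot x₀⟩ with r₀ hr₀
  let S : Set (E × ℝ) := {p | g p.1 ≤ (p.2 : EReal)}
  have hS : Convex ℝ S := by
    rintro ⟨x, r⟩ hx ⟨y, s⟩ hy a b ha hb hab
    exact hconv.epiConvex x y a b r s ha hb hab hx hy
  have hclosed : IsClosed S :=
    hlsc.isClosed_epigraph.preimage
      (continuous_fst.prodMk (continuous_coe_real_ereal.comp continuous_snd))
  have hnot : (x₀, r₀ - 1) ∉ S := by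
    intro h
    have h' : g x₀ ≤ ((r₀ - 1 : ℝ) : EReal) := h
    rw [← hr₀, EReal.coe_le_coe_iff] at h'
    linarith
  obtain ⟨φ, u, hu, hφ⟩ := geometric_hahn_banach_point_closed hS hclosed hnot
  let ψ : StrongDual ℝ E := φ.comp (ContinuousLinearMap.inl ℝ E ℝ)
  have hsplit (x : E) (r : ℝ) : φ (x, r) = ψ x + φ (0, 1) * r := by
    have h : ((x, r) : E × ℝ) = (x, 0) + r • (0, 1) := by simp
    rw [h, map_add, map_smul, smul_eq_mul, mul_comm]
    rfl
  set c := φ (0, 1)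
  have h₀ := hφ (x₀, r₀) hr₀.ge
  rw [hsplit] at hu h₀
  have hc : 0 < c := by linarith
  refine ⟨(-c⁻¹) • (InnerProductSpace.toDual ℝ E).symm ψ, ne_top_of_le_ne_top
    (EReal.coe_ne_top (-u / c)) ((econj_le_coe_iff hbot).2 fun x s hs => ?_)⟩
  have h := hφ (x, s) hs.le
  rw [hsplit] at h
  rw [real_inner_smul_right, real_inner_comm, InnerProductSpace.toDual_symm_apply, le_div_iff₀ hc]
  have : (-c⁻¹ * ψ x - s) * c = -ψ x - c * s := by field_simp
  linarith

theorem eproper_econj [CompleteSpace E] (hg : EProper g) (hconv : EConvex g)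
    (hlsc : LowerSemicontinuous g) : EProper (EConj g) :=
  ⟨exists_econj_ne_top hg hconv hlsc, econj_ne_bot hg⟩

end Conjugate

section Subdifferential

variable {E : Type*} [NormedAddCommGroup E] [InnerProductSpace ℝ E] {f : E → EReal}

theorem add_inner_le_of_mem_esubdiff {x z u : E} {r s : ℝ} (hu : u ∈ ESubdiff f x)
    (hx : f x = (r : EReal)) (hz : f z = (s : EReal)) : r + ⟪u, z - x⟫ ≤ s := by
  have h := hu z
  rw [hx, hz] at h
  exact_mod_cast h

theorem exists_eq_coe_of_mem_esubdiff (hf : EProper f) {x u : E} (hu : u ∈ ESubdiff f x) :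
    ∃ r : ℝ, f x = (r : EReal) := by
  obtain ⟨⟨z, hz⟩, hbot⟩ := hf
  refine ⟨(f x).toReal, (EReal.coe_toReal (fun h => hz ?_) (hbot x)).symm⟩
  have h' := hu z
  rwa [h, EReal.top_add_coe, top_le_iff] at h'

theorem inner_nonneg_of_mem_esubdiff (hf : EProper f) {x z u v : E} (hu : u ∈ ESubdiff f x)
    (hv : v ∈ ESubdiff f z) : 0 ≤ ⟪u - v, x - z⟫ := by
  obtain ⟨r, hr⟩ := exists_eq_coe_of_mem_esubdiff hf hu
  obtain ⟨s, hs⟩ := exists_eq_coe_of_mem_esubdiff hf hv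
  have h₁ := add_inner_le_of_mem_esubdiff hu hr hs
  have h₂ := add_inner_le_of_mem_esubdiff hv hs hr
  rw [← neg_sub x z, inner_neg_right] at h₁
  rw [inner_sub_left]
  linarith

theorem IsProx.mem_esubdiff (hf : EProper f) (hconv : EpiConvex f) {τ : ℝ} (hτ : 0 < τ)
    {x p : E} (hp : IsProx τ f x p) : τ⁻¹ • (x - p) ∈ ESubdiff f p := by
  obtain ⟨⟨z₀, hz₀⟩, hbot⟩ := hf
  have hptop : f p ≠ ⊤ := by
    intro h
    have h' := hp z₀
    rw [h, EReal.top_add_coe, top_le_iff] at h'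
    lift f z₀ to ℝ using ⟨hz₀, hbot z₀⟩ with r
    exact EReal.coe_ne_top _ h'
  obtain ⟨r, hr⟩ : ∃ r : ℝ, f p = (r : EReal) := ⟨_, (EReal.coe_toReal hptop (hbot p)).symm⟩
  intro z
  by_cases hz : f z = ⊤
  · rw [hz]; exact le_top
  obtain ⟨s, hs⟩ : ∃ s : ℝ, f z = (s : EReal) := ⟨_, (EReal.coe_toReal hz (hbot z)).symm⟩
  rw [hr, hs, ← EReal.coe_add, EReal.coe_le_coe_iff]
  have key (t : ℝ) (ht : t ∈ Set.Ioo (0 : ℝ) 1) :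
      0 ≤ s - (r + ⟪τ⁻¹ • (x - p), z - p⟫) + t * (1 / (2 * τ) * ‖z - p‖ ^ 2) := by
    have h₁ := hconv p z (1 - t) t r s (by linarith [ht.2]) ht.1.le (by ring) hr.le hs.le
    have h₂ := (hp ((1 - t) • p + t • z)).trans (add_le_add_left h₁ _)
    rw [hr, ← EReal.coe_add, ← EReal.coe_add, EReal.coe_le_coe_iff] at h₂
    have h₃ : (1 - t) • p + t • z - x = (p - x) + t • (z - p) := by module
    have h₄ : ⟪x - p, z - p⟫ = -⟪p - x, z - p⟫ := by rw [← inner_neg_left, neg_sub]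
    rw [h₃, norm_add_sq_real, norm_smul, mul_pow, Real.norm_eq_abs, sq_abs,
      real_inner_smul_right] at h₂
    rw [real_inner_smul_left, h₄]
    refine nonneg_of_mul_nonneg_right ?_ ht.1
    have : 1 / (2 * τ) * (2 * (t * ⟪p - x, z - p⟫)) = t * (τ⁻¹ * ⟪p - x, z - p⟫) := by
      field_simp
    linarith
  have hlim : Tendsto (fun t : ℝ => s - (r + ⟪τ⁻¹ • (x - p), z - p⟫)
      + t * (1 / (2 * τ) * ‖z - p‖ ^ 2)) (𝓝[>] 0)
      (𝓝 (s - (r + ⟪τ⁻¹ • (x - p), z - p⟫) + 0 * (1 / (2 * τ) * ‖z - p‖ ^ 2))) :=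
    (Continuous.tendsto (by fun_prop) 0).mono_left nhdsWithin_le_nhds
  have := ge_of_tendsto hlim
    (Filter.mem_of_superset (Ioo_mem_nhdsGT one_pos) key)
  linarith

end Subdifferential

section Lyapunov

variable {E F : Type*} [NormedAddCommGroup E] [InnerProductSpace ℝ E]
  [NormedAddCommGroup F] [InnerProductSpace ℝ F]

theorem mul_inner_map_le (L : E →L[ℝ] F) {p q m : ℝ} (hq : 0 < q) (hm : 0 < m)
    (h : m * ‖L‖ ^ 2 = 4 * p * q) (e : F) (w : E) :
    m * ⟪e, L w⟫ ≤ m * (q / 2 * ‖e‖ ^ 2) + 2 * p * ‖w‖ ^ 2 := by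
  have h₁ : ‖L w‖ ^ 2 ≤ ‖L‖ ^ 2 * ‖w‖ ^ 2 := by
    rw [← mul_pow]; gcongr; exact L.le_opNorm w
  have h₂ : 0 ≤ ‖q • e - L w‖ ^ 2 := by positivity
  rw [norm_sub_sq_real, norm_smul, mul_pow, Real.norm_eq_abs, sq_abs, real_inner_smul_left] at h₂
  have h₃ : m * (q ^ 2 * ‖e‖ ^ 2 - 2 * (q * ⟪e, L w⟫) + ‖L w‖ ^ 2) ≥ 0 := by positivity
  have h₄ := mul_le_mul_of_nonneg_left h₁ hm.le
  have h₅ : m * (‖L‖ ^ 2 * ‖w‖ ^ 2) = 4 * p * q * ‖w‖ ^ 2 := by rw [← mul_assoc, h]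
  refine le_of_mul_le_mul_left ?_ hq
  linarith

/-- A Lyapunov function for the Chambolle–Pock iteration in coordinates centred at a saddle point,
with `p = τ⁻¹`, `q = σ⁻¹`; `φ` holds the values of the tilted primal function along `X`. -/
theorem exists_lyapunov (L : E →L[ℝ] F) {p q θ : ℝ} (hp : 0 < p) (hq : 0 < q) (hθ : 1 / 2 < θ)
    (hstep : (1 + 2 * θ) * ‖L‖ ^ 2 = 4 * p * q) (X : ℕ → E) (Y : ℕ → F) (φ : ℕ → ℝ)
    (hφ : ∀ k, 0 ≤ φ k)
    (hzero : ∀ k, φ (k + 1) ≤ p * ⟪X k - X (k + 1), X (k + 1)⟫ - ⟪Y k, L (X (k + 1))⟫)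
    (hsub : ∀ k j, φ (k + 1) + p * ⟪X k - X (k + 1), X j - X (k + 1)⟫
      - ⟪Y k, L (X j - X (k + 1))⟫ ≤ φ j)
    (hdual : ∀ k, 0 ≤ q * ⟪Y k - Y (k + 1), Y (k + 1)⟫
      + ⟪L (X (k + 1) + θ • (X (k + 1) - X k)), Y (k + 1)⟫) :
    ∃ V : ℕ → ℝ, (∀ k, 0 ≤ V k) ∧ ∀ k,
      V (k + 1) + p * (2 * θ - 1) / 4 * ‖X (k + 2) - X k‖ ^ 2 ≤ V k := by
  have hm : 0 < 1 + 2 * θ := by linarith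
  have young := mul_inner_map_le L hq hm hstep
  rcases le_total 1 θ with h1 | h1
  · refine ⟨fun k => (1 + 2 * θ) * (p / 2 * ‖X (k + 1)‖ ^ 2 + q / 2 * ‖Y k‖ ^ 2
      + ⟪Y k, L (X (k + 1) - X k)⟫ + 3 / 4 * p * ‖X (k + 1) - X k‖ ^ 2 + (θ - 1) * φ k),
      fun k => ?_, fun k => ?_⟩
    · have hy := young (Y k) (-(X (k + 1) - X k))
      rw [map_neg, inner_neg_right, norm_neg] at hy
      have h₂ : 0 ≤ (1 + 2 * θ) * (p / 2 * ‖X (k + 1)‖ ^ 2) := by positivity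
      have h₃ : 0 ≤ (1 + 2 * θ) * ((θ - 1) * φ k) :=
        mul_nonneg hm.le (mul_nonneg (by linarith) (hφ k))
      have h₄ : 0 ≤ (3 / 4 * (1 + 2 * θ) - 2) * (p * ‖X (k + 1) - X k‖ ^ 2) :=
        mul_nonneg (by linarith) (by positivity)
      linarith
    · have hy := young (Y (k + 1) - Y k)
        (θ • (X (k + 1) - X k) - (1 / 2 : ℝ) • (X (k + 2) - X (k + 1)))
      have hA := mul_le_mul_of_nonneg_left (hzero (k + 1)) hm.le
      have hG := mul_le_mul_of_nonneg_left (hdual k) hm.le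
      have hB' := mul_le_mul_of_nonneg_left (hsub k k)
        (mul_nonneg hm.le (sub_nonneg.2 h1))
      have hB := mul_le_mul_of_nonneg_left (hsub (k + 1) (k + 1)) hm.le
      have hC := mul_le_mul_of_nonneg_left (hsub k (k + 2)) hm.le
      have hF := mul_nonneg hm.le (hφ (k + 2))
      simp only [add_assoc, Nat.reduceAdd, ← real_inner_self_eq_norm_sq, map_add, map_sub,
        map_smul, inner_add_left, inner_sub_left, inner_sub_right,
        real_inner_smul_left, real_inner_smul_right,
        real_inner_comm (X k) (X (k + 1)), real_inner_comm (X k) (X (k + 2)),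
        real_inner_comm (X (k + 1)) (X (k + 2)), real_inner_comm (Y k) (Y (k + 1)),
        real_inner_comm (Y (k + 1)) (L _)] at *
      linarith
  · refine ⟨fun k => (1 + 2 * θ) * (p / 2 * ‖X (k + 1)‖ ^ 2 + q / 2 * ‖Y k‖ ^ 2
      + θ * ⟪Y k, L (X (k + 1) - X k)⟫ + (θ - 1 / 4) * p * ‖X (k + 1) - X k‖ ^ 2),
      fun k => ?_, fun k => ?_⟩
    · have hy := young (Y k) ((-θ) • (X (k + 1) - X k))
      rw [map_smul, real_inner_smul_right, norm_smul, mul_pow, Real.norm_eq_abs, sq_abs] at hy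
      have h₂ : 0 ≤ (1 + 2 * θ) * (p / 2 * ‖X (k + 1)‖ ^ 2) := by positivity
      have h₄ : 0 ≤ (θ / 2 - 1 / 4) * (p * ‖X (k + 1) - X k‖ ^ 2) :=
        mul_nonneg (by linarith) (by positivity)
      linarith
    · have hy := young (Y (k + 1) - Y k)
        (θ • (X (k + 1) - X k) - (1 / 2 : ℝ) • (X (k + 2) - X (k + 1)))
      have hA := mul_le_mul_of_nonneg_left (hzero (k + 1)) hm.le
      have hG := mul_le_mul_of_nonneg_left (hdual k) hm.le
      have hB := mul_le_mul_of_nonneg_left (hsub (k + 1) (k + 1))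
        (mul_nonneg hm.le (by linarith : 0 ≤ θ - 1 / 2))
      have hC := mul_le_mul_of_nonneg_left (hsub k (k + 2)) hm.le
      have hF := mul_nonneg (mul_nonneg hm.le (by linarith : 0 ≤ θ)) (hφ (k + 2))
      have hF' := mul_nonneg (mul_nonneg hm.le (sub_nonneg.2 h1)) (hφ (k + 1))
      simp only [add_assoc, Nat.reduceAdd, ← real_inner_self_eq_norm_sq, map_add, map_sub,
        map_smul, inner_add_left, inner_sub_left, inner_sub_right,
        real_inner_smul_left, real_inner_smul_right,
        real_inner_comm (X k) (X (k + 1)), real_inner_comm (X k) (X (k + 2)),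
        real_inner_comm (X (k + 1)) (X (k + 2)), real_inner_comm (Y k) (Y (k + 1)),
        real_inner_comm (Y (k + 1)) (L _)] at *
      linarith

end Lyapunov

theorem summable_of_add_mul_le {V a : ℕ → ℝ} {c : ℝ} (hc : 0 < c) (ha : ∀ k, 0 ≤ a k)
    (hV : ∀ k, 0 ≤ V k) (h : ∀ k, V (k + 1) + c * a k ≤ V k) : Summable a := by
  refine summable_of_sum_range_le (c := V 0 / c) ha fun n => ?_
  rw [le_div_iff₀ hc]
  have : V n + c * ∑ i ∈ Finset.range n, a i ≤ V 0 := by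
    induction n with
    | zero => simp
    | succ n ih => rw [Finset.sum_range_succ]; linarith [h n]
  linarith [hV n]

theorem boundary_summable
    {𝓗 𝓖 : Type*}
    [NormedAddCommGroup 𝓗] [InnerProductSpace ℝ 𝓗] [CompleteSpace 𝓗]
    [NormedAddCommGroup 𝓖] [InnerProductSpace ℝ 𝓖] [CompleteSpace 𝓖]
    (f : 𝓗 → EReal) (g : 𝓖 → EReal) (gs : 𝓖 → EReal)
    (hf₁ : EProper f) (hf₂ : EConvex f) (hf₃ : LowerSemicontinuous f)
    (hg₁ : EProper g) (hg₂ : EConvex g) (hg₃ : LowerSemicontinuous g)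
    (hgs : gs = EConj g)
    (L : 𝓗 →L[ℝ] 𝓖) (hL : L ≠ 0)
    (τ σ θ : ℝ) (hτ : 0 < τ) (hσ : 0 < σ)
    (hθ : 1 / 2 < θ) (hstep : τ * σ * ‖L‖ ^ 2 = 4 / (1 + 2 * θ))
    (hexist : ∃ (xstar : 𝓗) (ystar : 𝓖),
      -((ContinuousLinearMap.adjoint L) ystar) ∈ ESubdiff f xstar ∧
        L xstar ∈ ESubdiff gs ystar)
    (x : ℕ → 𝓗) (y : ℕ → 𝓖)
    (hx : ∀ k : ℕ, IsProx τ f (x k - τ • (ContinuousLinearMap.adjoint L) (y k)) (x (k + 1)))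
    (hy : ∀ k : ℕ,
      IsProx σ gs (y k + σ • L (x (k + 1) + θ • (x (k + 1) - x k))) (y (k + 1)))
    :
    Summable (fun k : ℕ => ‖x (k + 2) - x k‖ ^ 2) ∧
    Tendsto (fun k : ℕ => ‖x (k + 2) - x k‖) atTop (𝓝 0) := by
  subst hgs
  have hconj := eproper_econj hg₁ hg₂ hg₃
  obtain ⟨xs, ys, hxs, hys⟩ := hexist
  have hu (k : ℕ) := (hx k).mem_esubdiff hf₁ hf₂.epiConvex hτ
  have hv (k : ℕ) := (hy k).mem_esubdiff hconj (epiConvex_econj hg₁.2) hσ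
  choose φ hφ using fun k => exists_eq_coe_of_mem_esubdiff hf₁ (hu k)
  obtain ⟨φs, hφs⟩ := exists_eq_coe_of_mem_esubdiff hf₁ hxs
  have hstep' : (1 + 2 * θ) * ‖L‖ ^ 2 = 4 * τ⁻¹ * σ⁻¹ := by
    have : 1 + 2 * θ ≠ 0 := by linarith
    field_simp at hstep ⊢
    linarith
  have hcancel (k : ℕ) (w : 𝓗) :
      ⟪τ⁻¹ • (x k - τ • (ContinuousLinearMap.adjoint L) (y k) - x (k + 1)), w⟫ =
        τ⁻¹ * ⟪x k - x (k + 1), w⟫ - ⟪y k, L w⟫ := by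
    rw [sub_right_comm, smul_sub, inv_smul_smul₀ hτ.ne', inner_sub_left, real_inner_smul_left,
      ContinuousLinearMap.adjoint_inner_left]
  have hstar (w : 𝓗) : ⟪-(ContinuousLinearMap.adjoint L) ys, w⟫ = -⟪ys, L w⟫ := by
    rw [inner_neg_left, ContinuousLinearMap.adjoint_inner_left]
  obtain ⟨V, hV₀, hV⟩ := exists_lyapunov L (inv_pos.2 hτ) (inv_pos.2 hσ) hθ hstep'
    (fun k => x (k + 1) - xs) (fun k => y (k + 1) - ys)
    (fun k => φ k - φs + ⟪ys, L (x (k + 1) - xs)⟫)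
    (fun k => by
      have h := add_inner_le_of_mem_esubdiff hxs hφs (hφ k)
      rw [hstar] at h
      linarith)
    (fun k => by
      have h := add_inner_le_of_mem_esubdiff (hu (k + 1)) (hφ (k + 1)) hφs
      rw [hcancel, ← neg_sub (x (k + 1 + 1)) xs, map_neg, inner_neg_right, inner_neg_right] at h
      rw [sub_sub_sub_cancel_right, inner_sub_left (y (k + 1))]
      linarith)
    (fun k j => by
      have h := add_inner_le_of_mem_esubdiff (hu (k + 1)) (hφ (k + 1)) (hφ j)
      rw [hcancel] at h
      simp only [sub_sub_sub_cancel_right, map_sub, inner_sub_left, inner_sub_right] at h ⊢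
      linarith)
    (fun k => by
      have h := inner_nonneg_of_mem_esubdiff hconj (hv (k + 1)) hys
      have e : σ⁻¹ • (y (k + 1) + σ • L (x (k + 1 + 1) + θ • (x (k + 1 + 1) - x (k + 1)))
          - y (k + 1 + 1)) - L xs = σ⁻¹ • (y (k + 1) - y (k + 1 + 1))
          + L (x (k + 1 + 1) - xs + θ • (x (k + 1 + 1) - x (k + 1))) := by
        rw [add_sub_right_comm, smul_add, inv_smul_smul₀ hσ.ne', add_sub_assoc, ← map_sub,
          add_sub_right_comm]
      rw [e, inner_add_left, real_inner_smul_left] at h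
      simpa only [sub_sub_sub_cancel_right] using h)
  have hsum : Summable (fun k : ℕ => ‖x (k + 2) - x k‖ ^ 2) := by
    rw [← summable_nat_add_iff 1]
    refine summable_of_add_mul_le (c := τ⁻¹ * (2 * θ - 1) / 4) ?_ (fun k => by positivity) hV₀
      fun k => by simpa only [sub_sub_sub_cancel_right, add_right_comm k 1 2] using hV k
    have : 0 < 2 * θ - 1 := by linarith
    positivity
  refine ⟨hsum, ?_⟩
  simpa using hsum.tendsto_atTop_zero.sqrt
end
end
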